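/- Let A be a generalized N-function on Ω satisfying condition Δ₂(Ω) and condition (A_∞): there exists a continuous function A_∞ : [0,∞) → [0,∞) with A_∞(α) → +∞ as α → +∞ such that A(x,αt) ≥ A_∞(α)·α·A(x,t) for all x ∈ Ω, t ≥ 0 and α > 0. Then for every u ∈ L^A(Ω) with ‖u‖_A > 0, the coercivity estimate ∫_Ω A(x,|u(x)|) dx ≥ A_∞(‖u‖_A)·‖u‖_A holds. -/

import Mathlib

open MeasureTheory Filter Topology

noncomputable section

/-- An N-function: a continuous, convex, even function `A : ℝ → [0,∞)` with `A t > 0` for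
`t ≠ 0`, `A t / t → 0` as `t → 0⁺` and `A t / t → +∞` as `t → +∞`. -/
def IsNFun (A : ℝ → ℝ) : Prop :=
  Continuous A ∧ ConvexOn ℝ Set.univ A ∧ (∀ t, A (-t) = A t) ∧
    (∀ t, 0 ≤ A t) ∧ (∀ t, t ≠ 0 → 0 < A t) ∧
    Tendsto (fun t => A t / t) (𝓝[>] (0:ℝ)) (𝓝 0) ∧
    Tendsto (fun t => A t / t) atTop atTop

/-- A generalized N-function on a set `Ω ⊆ ℝ^N`: `A (·, t)` is measurable for every `t ≥ 0`
and `A (x, ·)` is an N-function for a.e. `x ∈ Ω`. -/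
def IsGNFunOn {N : ℕ} (Ω : Set (Fin N → ℝ)) (A : (Fin N → ℝ) → ℝ → ℝ) : Prop :=
  (∀ t : ℝ, 0 ≤ t → Measurable fun x => A x t) ∧
    (∀ᵐ x ∂(volume.restrict Ω), IsNFun (A x))

/-- The right-hand derivative of `f` at `t`. -/
def rdPos (f : ℝ → ℝ) (t : ℝ) : ℝ := derivWithin f (Set.Ici t) t

/-- The right-hand derivative, extended to negative arguments by `rd f t = - rdPos f (-t)`. -/
def rd (f : ℝ → ℝ) (t : ℝ) : ℝ := if 0 ≤ t then rdPos f t else - rdPos f (-t)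

/-- The complementary function (Young conjugate): `Ã(x,s) = sup_{t ∈ ℝ} (s·t − A(x,t))`. -/
def conjFun {α : Type*} (A : α → ℝ → ℝ) (x : α) (s : ℝ) : ℝ := ⨆ t : ℝ, (s * t - A x t)

/-- The Luxemburg norm of `u` on `Ω`:
`‖u‖_A = inf {λ > 0 : ∫_Ω A(x, |u x| / λ) dx ≤ 1}`. -/
def luxNormOn {N : ℕ} (Ω : Set (Fin N → ℝ)) (A : (Fin N → ℝ) → ℝ → ℝ)
    (u : (Fin N → ℝ) → ℝ) : ℝ :=
  sInf {l : ℝ | 0 < l ∧ ∫⁻ x in Ω, ENNReal.ofReal (A x (|u x| / l)) ≤ 1}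

/-- Membership in the Musielak-Orlicz space `L^A(Ω)`: `u` is measurable and
`∫_Ω A(x, |u x| / λ) dx < ∞` for some `λ > 0`. -/
def MemLuxOn {N : ℕ} (Ω : Set (Fin N → ℝ)) (A : (Fin N → ℝ) → ℝ → ℝ)
    (u : (Fin N → ℝ) → ℝ) : Prop :=
  AEMeasurable u (volume.restrict Ω) ∧
    ∃ l : ℝ, 0 < l ∧ ∫⁻ x in Ω, ENNReal.ofReal (A x (|u x| / l)) < ⊤

/-- The condition `Δ₂(Ω)`: `A(x, 2t) ≤ K·A(x,t) + h(x)` for some `K > 0` and some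
nonnegative `h ∈ L¹(Ω)`. -/
def Delta2On {N : ℕ} (Ω : Set (Fin N → ℝ)) (A : (Fin N → ℝ) → ℝ → ℝ) : Prop :=
  ∃ K : ℝ, 0 < K ∧ ∃ h : (Fin N → ℝ) → ℝ, IntegrableOn h Ω volume ∧ (∀ x, 0 ≤ h x) ∧
    ∀ x ∈ Ω, ∀ t : ℝ, A x (2 * t) ≤ K * A x t + h x

/-- `A ≼ B`: `A(x,t) ≤ K₁·B(x,K₂·t) + h(x)` for some `K₁, K₂ > 0` and some
nonnegative `h ∈ L¹(Ω)`, for all `x ∈ Ω` and `t ≥ 0`. -/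
def PrecOn {N : ℕ} (Ω : Set (Fin N → ℝ)) (A B : (Fin N → ℝ) → ℝ → ℝ) : Prop :=
  ∃ K₁ K₂ : ℝ, 0 < K₁ ∧ 0 < K₂ ∧ ∃ h : (Fin N → ℝ) → ℝ, IntegrableOn h Ω volume ∧
    (∀ x, 0 ≤ h x) ∧ ∀ x ∈ Ω, ∀ t : ℝ, 0 ≤ t → A x t ≤ K₁ * B x (K₂ * t) + h x

/-- A generalized N-function with respect to a measure `μ`. -/
def IsGNFunM {α : Type*} [MeasurableSpace α] (μ : Measure α) (A : α → ℝ → ℝ) : Prop :=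
  (∀ t : ℝ, 0 ≤ t → Measurable fun x => A x t) ∧ (∀ᵐ x ∂μ, IsNFun (A x))

/-- The Luxemburg norm with respect to a measure `μ`. -/
def luxNormM {α : Type*} [MeasurableSpace α] (μ : Measure α) (A : α → ℝ → ℝ)
    (u : α → ℝ) : ℝ :=
  sInf {l : ℝ | 0 < l ∧ ∫⁻ x, ENNReal.ofReal (A x (|u x| / l)) ∂μ ≤ 1}

end

/-- An N-function is monotone on `[0,∞)`. -/
theorem IsNFun.mono {A : ℝ → ℝ} (hA : IsNFun A) {s t : ℝ} (hs : 0 ≤ s) (hst : s ≤ t) :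
    A s ≤ A t := by
  obtain ⟨-, hconv, heven, -⟩ := hA
  have h := hconv.le_max_of_mem_Icc (x := -t) (y := t) (z := s) trivial trivial
    ⟨by linarith, hst⟩
  simpa [heven] using h

/-- Superposition of a Carathéodory function with a nonnegative measurable function. -/
theorem aemeasurable_caratheodory_comp {α : Type*} [MeasurableSpace α] {μ : Measure α}
    {A : α → ℝ → ℝ} (hmeas : ∀ t : ℝ, 0 ≤ t → Measurable fun x => A x t)
    (hcont : ∀ᵐ x ∂μ, Continuous (A x)) {v : α → ℝ} (hv : AEMeasurable v μ)
    (hv0 : ∀ x, 0 ≤ v x) : AEMeasurable (fun x => A x (v x)) μ := by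
  refine aemeasurable_of_tendsto_metrizable_ae (u := atTop)
    (f := fun (n : ℕ) x => A x ((⌊v x * n⌋₊ : ℝ) / n)) (fun n => ?_) ?_
  · have hF : Measurable fun p : α × ℕ => A p.1 ((p.2 : ℝ) / n) :=
      measurable_from_prod_countable_left fun k =>
        hmeas _ (div_nonneg k.cast_nonneg n.cast_nonneg)
    exact hF.comp_aemeasurable
      (aemeasurable_id.prodMk (Nat.measurable_floor.comp_aemeasurable (hv.mul_const _)))
  · filter_upwards [hcont] with x hx
    exact (hx.tendsto (v x)).comp
      ((tendsto_nat_floor_mul_div_atTop (hv0 x)).comp tendsto_natCast_atTop_atTop)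

/-- Under `Δ₂(Ω)`, doubling preserves finiteness of the modular. -/
theorem Delta2On.lintegral_two_mul_lt_top {N : ℕ} {Ω : Set (Fin N → ℝ)}
    (hΩ : MeasurableSet Ω) {A : (Fin N → ℝ) → ℝ → ℝ} (hΔ : Delta2On Ω A)
    {v : (Fin N → ℝ) → ℝ} (hv : ∫⁻ x in Ω, ENNReal.ofReal (A x (v x)) < ⊤) :
    ∫⁻ x in Ω, ENNReal.ofReal (A x (2 * v x)) < ⊤ := by
  obtain ⟨K, hK, h, hint, -, hle⟩ := hΔ
  calc ∫⁻ x in Ω, ENNReal.ofReal (A x (2 * v x))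
      ≤ ∫⁻ x in Ω, (ENNReal.ofReal K * ENNReal.ofReal (A x (v x)) + ENNReal.ofReal (h x)) := by
        refine setLIntegral_mono' hΩ fun x hx => ?_
        rw [← ENNReal.ofReal_mul hK.le]
        exact (ENNReal.ofReal_le_ofReal (hle x hx _)).trans ENNReal.ofReal_add_le
    _ = ENNReal.ofReal K * (∫⁻ x in Ω, ENNReal.ofReal (A x (v x)))
          + ∫⁻ x in Ω, ENNReal.ofReal (h x) := by
        rw [lintegral_add_right' _ hint.aemeasurable.ennreal_ofReal,
          lintegral_const_mul' _ _ ENNReal.ofReal_ne_top]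
    _ < ⊤ := ENNReal.add_lt_top.2
        ⟨ENNReal.mul_lt_top ENNReal.ofReal_lt_top hv, Integrable.lintegral_lt_top hint⟩

/-- Under `Δ₂(Ω)`, every element of `L^A(Ω)` has finite modular. -/
theorem MemLuxOn.lintegral_lt_top {N : ℕ} {Ω : Set (Fin N → ℝ)}
    (hΩ : MeasurableSet Ω) {A : (Fin N → ℝ) → ℝ → ℝ} (hA : IsGNFunOn Ω A)
    (hΔ : Delta2On Ω A) {u : (Fin N → ℝ) → ℝ} (hu : MemLuxOn Ω A u) :
    ∫⁻ x in Ω, ENNReal.ofReal (A x |u x|) < ⊤ := by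
  obtain ⟨-, l, hl, hfin⟩ := hu
  have hpow : ∀ k : ℕ, ∫⁻ x in Ω, ENNReal.ofReal (A x (2 ^ k * (|u x| / l))) < ⊤ := by
    intro k
    induction k with
    | zero => simpa using hfin
    | succ k ih => simpa [pow_succ', mul_assoc] using hΔ.lintegral_two_mul_lt_top hΩ ih
  obtain ⟨k, hk⟩ := pow_unbounded_of_one_lt l (one_lt_two (α := ℝ))
  refine (lintegral_mono_ae ?_).trans_lt (hpow k)
  filter_upwards [hA.2] with x hx
  refine ENNReal.ofReal_le_ofReal (hx.mono (abs_nonneg _) ?_)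
  calc |u x| = l * (|u x| / l) := by field_simp
    _ ≤ 2 ^ k * (|u x| / l) := by gcongr

/-- Below the Luxemburg norm the modular exceeds one. -/
theorem one_lt_lintegral_of_lt_luxNormOn {N : ℕ} {Ω : Set (Fin N → ℝ)}
    {A : (Fin N → ℝ) → ℝ → ℝ} {u : (Fin N → ℝ) → ℝ} {l : ℝ} (hl : 0 < l)
    (hlt : l < luxNormOn Ω A u) :
    1 < ∫⁻ x in Ω, ENNReal.ofReal (A x (|u x| / l)) := by
  by_contra! hle
  exact hlt.not_ge (csInf_le ⟨0, fun _ hy => hy.1.le⟩ ⟨hl, hle⟩)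

/-- Let `A` satisfy `Δ₂(Ω)` and condition `(A_∞)`: there is a continuous
`A_∞ : [0,∞) → [0,∞)` with `A_∞(α) → +∞` as `α → +∞` and
`A(x,αt) ≥ A_∞(α)·α·A(x,t)` for all `x ∈ Ω`, `t ≥ 0`, `α > 0`. Then for every `u ∈ L^A(Ω)`
with `‖u‖_A > 0`, `∫_Ω A(x,|u(x)|) dx ≥ A_∞(‖u‖_A)·‖u‖_A`. -/
theorem statement17 {N : ℕ} (Ω : Set (Fin N → ℝ)) (hΩ : MeasurableSet Ω)
    (A : (Fin N → ℝ) → ℝ → ℝ) (hA : IsGNFunOn Ω A) (hΔ : Delta2On Ω A)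
    (Ainf : ℝ → ℝ) (hAinfCont : ContinuousOn Ainf (Set.Ici 0))
    (hAinfNonneg : ∀ a : ℝ, 0 ≤ a → 0 ≤ Ainf a)
    (hAinfTop : Tendsto Ainf atTop atTop)
    (hAinf : ∀ x ∈ Ω, ∀ t : ℝ, 0 ≤ t → ∀ α : ℝ, 0 < α →
      Ainf α * α * A x t ≤ A x (α * t))
    (u : (Fin N → ℝ) → ℝ) (hu : MemLuxOn Ω A u) (hpos : 0 < luxNormOn Ω A u) :
    Ainf (luxNormOn Ω A u) * luxNormOn Ω A u ≤ ∫ x in Ω, A x |u x| := by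
  have hmeas : AEMeasurable (fun x => A x |u x|) (volume.restrict Ω) :=
    aemeasurable_caratheodory_comp hA.1 (hA.2.mono fun _ hx => hx.1) hu.1.norm
      fun _ => abs_nonneg _
  have hnonneg : 0 ≤ᵐ[volume.restrict Ω] fun x => A x |u x| :=
    hA.2.mono fun _ hx => hx.2.2.2.1 _
  have hfin := hu.lintegral_lt_top hΩ hA hΔ
  have key : ∀ l, 0 < l → l < luxNormOn Ω A u → Ainf l * l ≤ ∫ x in Ω, A x |u x| := by
    intro l hl hlt
    have hc : 0 ≤ Ainf l * l := mul_nonneg (hAinfNonneg l hl.le) hl.le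
    rw [integral_eq_lintegral_of_nonneg_ae hnonneg hmeas.aestronglyMeasurable,
      ← ENNReal.ofReal_le_iff_le_toReal hfin.ne]
    calc ENNReal.ofReal (Ainf l * l)
        ≤ ENNReal.ofReal (Ainf l * l) * ∫⁻ x in Ω, ENNReal.ofReal (A x (|u x| / l)) :=
          le_mul_of_one_le_right' (one_lt_lintegral_of_lt_luxNormOn hl hlt).le
      _ = ∫⁻ x in Ω, ENNReal.ofReal (Ainf l * l * A x (|u x| / l)) := by
          simp_rw [ENNReal.ofReal_mul hc]
          rw [lintegral_const_mul' _ _ ENNReal.ofReal_ne_top]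
      _ ≤ ∫⁻ x in Ω, ENNReal.ofReal (A x |u x|) := by
          refine setLIntegral_mono' hΩ fun x hx => ENNReal.ofReal_le_ofReal ?_
          simpa [mul_div_cancel₀ _ hl.ne'] using
            hAinf x hx (|u x| / l) (by positivity) l hl
  have hcont : ContinuousAt (fun l => Ainf l * l) (luxNormOn Ω A u) :=
    (hAinfCont.continuousAt (Ici_mem_nhds hpos)).mul continuousAt_id
  refine le_of_tendsto (hcont.mono_left (nhdsWithin_le_nhds (s := Set.Iio (luxNormOn Ω A u)))) ?_
  filter_upwards [Ioo_mem_nhdsLT hpos] with l hl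
  exact key l hl.1 hl.2
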